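/- arXiv:1705.05083 — 2 statements merged into one kernel-verified Lean document; each statement's English description precedes it below -/
import Mathlib

section
/- Let G be a finite group, N a normal subgroup of G with G/N abelian, and χ a complex irreducible character of G. Then the (positive integer) inner product ⟨Res_N χ, Res_N χ⟩_N divides the index [G : N·Z(G)], where N·Z(G) is the subgroup of G generated by N and the center Z(G). -/
open scoped BigOperators

/-- The standard inner product of complex class functions on a finite group:
`⟨f, f'⟩ = |G|⁻¹ ∑_{g ∈ G} f g * conj (f' g)`. -/
noncomputable def charInner (G : Type) [Group G] [Finite G] (f f' : G → ℂ) : ℂ :=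
  (Nat.card G : ℂ)⁻¹ * ∑ᶠ g : G, f g * (starRingEnd ℂ) (f' g)

/-- `χ : G → ℂ` is an irreducible character if it is the character of some
irreducible (simple) finite-dimensional complex representation of `G`. -/
def IsIrreducibleCharacter (G : Type) [Group G] (χ : G → ℂ) : Prop :=
  ∃ V : FDRep ℂ G, CategoryTheory.Simple V ∧ χ = V.character

namespace FDRep

open CategoryTheory

variable {G : Type} [Group G]

/-- The twist of a representation by a linear character. -/
noncomputable def twist (V : FDRep ℂ G) (θ : G →* ℂˣ) : FDRep ℂ G :=
  FDRep.of (V := V)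
    { toFun := fun g => (θ g : ℂ) • V.ρ g
      map_one' := by simp
      map_mul' := fun g h => by
        simp [smul_smul, mul_comm] }

theorem character_twist (V : FDRep ℂ G) (θ : G →* ℂˣ) (g : G) :
    (V.twist θ).character g = θ g * V.character g :=
  (map_smul (LinearMap.trace ℂ V) (θ g : ℂ) (V.ρ g)).trans (smul_eq_mul _ _)

variable [Finite G]

theorem simple_twist (V : FDRep ℂ G) [Simple V] (θ : G →* ℂˣ) : Simple (V.twist θ) := by
  have := Fintype.ofFinite G
  rw [FDRep.simple_iff_char_is_norm_one]
  rw [← (FDRep.simple_iff_char_is_norm_one V).1 inferInstance]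
  refine Finset.sum_congr rfl fun g _ => ?_
  rw [character_twist, character_twist, map_inv, Units.val_inv_eq_inv_val]
  field_simp

theorem finrank_ne_zero_of_simple (V : FDRep ℂ G) [Simple V] : Module.finrank ℂ V ≠ 0 := by
  intro h
  have := Fintype.ofFinite G
  have hsub : Subsingleton V := Module.finrank_zero_iff.1 h
  have hzero : ∀ g, V.character g = 0 := fun g => by
    rw [FDRep.character, Subsingleton.elim (V.ρ g) 0, map_zero]
  have hsum := (FDRep.simple_iff_char_is_norm_one V).1 inferInstance
  simp only [hzero, mul_zero, Finset.sum_const_zero] at hsum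
  exact NeZero.ne (Nat.card G : ℂ) hsum.symm

open scoped Classical in
theorem sum_linear_mul_character_mul_character_inv [Fintype G] (V : FDRep ℂ G) [Simple V]
    (θ : G →* ℂˣ) :
    (Nat.card G : ℂ)⁻¹ * ∑ g, (θ g : ℂ) * (V.character g * V.character g⁻¹) =
      if ∀ g, (θ g : ℂ) * V.character g = V.character g then 1 else 0 := by
  have hsimple := V.simple_twist θ
  have := invertibleOfNonzero (NeZero.ne (Nat.card G : ℂ))
  split_ifs with hfix
  · simp_rw [← mul_assoc, hfix]
    rw [(FDRep.simple_iff_char_is_norm_one V).1 inferInstance]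
    exact inv_mul_cancel₀ (NeZero.ne _)
  · have horth := FDRep.char_orthonormal (V.twist θ) V
    rw [if_neg] at horth
    · simpa only [character_twist, mul_assoc] using horth
    · rintro ⟨i⟩
      exact hfix fun g => by rw [← character_twist, FDRep.char_iso i]

theorem character_center_ne_zero (V : FDRep ℂ G) [Simple V] {z : G}
    (hz : z ∈ Subgroup.center G) : V.character z ≠ 0 := by
  let f : V ⟶ V := ⟨Action.ρ V z, fun g => by
    change Action.ρ V z * Action.ρ V g = Action.ρ V g * Action.ρ V z
    rw [← map_mul, ← map_mul, Subgroup.mem_center_iff.1 hz]⟩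
  obtain ⟨c, hc⟩ := endomorphism_simple_eq_smul_id ℂ f
  have hρ : V.ρ z = c • LinearMap.id := by
    have := congrArg (fun f : V ⟶ V => f.hom.hom.hom) hc
    exact this.symm
  have hne : V.ρ z ≠ 0 := by
    intro h
    have hone : V.ρ (z * z⁻¹) = 0 := by rw [map_mul, h, zero_mul]
    rw [mul_inv_cancel, map_one] at hone
    have htrace := congrArg (LinearMap.trace ℂ V) hone
    rw [LinearMap.trace_one, map_zero] at htrace
    exact V.finrank_ne_zero_of_simple (by exact_mod_cast htrace)
  rw [FDRep.character, hρ, map_smul, LinearMap.trace_id, smul_eq_mul]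
  refine mul_ne_zero ?_ (by exact_mod_cast V.finrank_ne_zero_of_simple)
  rintro rfl
  exact hne (by rw [hρ, zero_smul])

open scoped Matrix ComplexOrder in
theorem trace_inv_eq_conj {n : Type*} [Fintype n] [DecidableEq n]
    (M : G →* Matrix n n ℂ) (g : G) :
    (M g⁻¹).trace = (starRingEnd ℂ) (M g).trace := by
  have := Fintype.ofFinite G
  let P := ∑ h, (M h)ᴴ * M h
  have hinv : ∀ h, M h * M h⁻¹ = 1 := fun h => by rw [← map_mul, mul_inv_cancel, map_one]
  have hP : P.PosDef := Matrix.posDef_sum Finset.univ_nonempty fun h _ => by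
    refine Matrix.PosDef.conjTranspose_mul_self _ (Matrix.mulVec_injective_of_isUnit ?_)
    exact IsUnit.of_mul_eq_one _ (hinv h)
  have hdet : IsUnit P.det := (Matrix.isUnit_iff_isUnit_det _).1 hP.isUnit
  have hPg : (M g)ᴴ * P = P * M g⁻¹ := by
    have hinvariant : (M g)ᴴ * P * M g = P := by
      simp only [P, Finset.mul_sum, Finset.sum_mul]
      refine Fintype.sum_equiv (Equiv.mulRight g) _ _ fun h => ?_
      simp [Matrix.conjTranspose_mul, Matrix.mul_assoc]
    calc (M g)ᴴ * P = (M g)ᴴ * P * (M g * M g⁻¹) := by rw [hinv, Matrix.mul_one]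
      _ = P * M g⁻¹ := by rw [← Matrix.mul_assoc, hinvariant]
  have hconj : (M g)ᴴ = P * M g⁻¹ * P⁻¹ := by
    rw [← hPg, Matrix.mul_nonsing_inv_cancel_right _ _ hdet]
  rw [starRingEnd_apply, ← Matrix.trace_conjTranspose, hconj, Matrix.trace_mul_comm,
    ← Matrix.mul_assoc, Matrix.nonsing_inv_mul _ hdet, Matrix.one_mul]

theorem character_inv_eq_conj (V : FDRep ℂ G) (g : G) :
    V.character g⁻¹ = (starRingEnd ℂ) (V.character g) := by
  let b := Module.finBasis ℂ V
  have h := trace_inv_eq_conj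
    ((LinearMap.toMatrixAlgEquiv b).toMulEquiv.toMonoidHom.comp V.ρ) g
  simp only [FDRep.character, LinearMap.trace_eq_matrix_trace ℂ b]
  exact h

end FDRep

theorem CommGroup.sum_linear_apply {A : Type*} [CommGroup A] [Finite A]
    [Fintype (A →* ℂˣ)] [DecidableEq A] (a : A) :
    ∑ θ : A →* ℂˣ, (θ a : ℂ) = if a = 1 then (Nat.card A : ℂ) else 0 := by
  split_ifs with ha
  · simp [ha, ← CommGroup.card_monoidHom_of_hasEnoughRootsOfUnity A ℂ]
  · obtain ⟨φ, hφ⟩ := CommGroup.exists_apply_ne_one_of_hasEnoughRootsOfUnity A ℂ ha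
    have hshift : (φ a : ℂ) * ∑ θ : A →* ℂˣ, (θ a : ℂ) = ∑ θ : A →* ℂˣ, (θ a : ℂ) := by
      rw [Finset.mul_sum]
      exact Fintype.sum_equiv (Equiv.mulLeft φ) _ _ fun θ => by simp
    by_contra hne
    exact hφ (Units.ext ((mul_eq_right₀ hne).1 hshift))

/-- The linear characters of a quotient `A` of `G` whose product with `χ` is `χ`. -/
def characterStabilizer {G A : Type*} [Group G] [CommGroup A] (π : G →* A) (χ : G → ℂ) :
    Subgroup (A →* ℂˣ) where
  carrier := {θ | ∀ g, (θ (π g) : ℂ) * χ g = χ g}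
  one_mem' g := by simp
  mul_mem' {θ η} hθ hη g := by simp [mul_assoc, hη g, hθ g]
  inv_mem' {θ} hθ g := by
    rw [MonoidHom.inv_apply, Units.inv_mul_eq_iff_eq_mul, hθ g]

theorem card_characterStabilizer_dvd_index {G A : Type*} [Group G] [CommGroup A] [Finite A]
    (π : G →* A) (hπ : Function.Surjective π) (χ : G → ℂ)
    (hχ : ∀ z ∈ Subgroup.center G, χ z ≠ 0) :
    Nat.card (characterStabilizer π χ) ∣ (π.ker ⊔ Subgroup.center G).index := by
  have hle : characterStabilizer π χ ≤
      (MonoidHom.domRestrictHom ((Subgroup.center G).map π) ℂˣ).ker := by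
    intro θ hθ
    rw [MonoidHom.mem_ker]
    ext ⟨_, z, hz, rfl⟩
    exact (mul_eq_right₀ (hχ z hz)).1 (hθ z)
  have hdvd := Subgroup.card_dvd_of_le hle
  rwa [CommGroup.card_domRestrictHom_ker, ← Subgroup.index,
    ← Subgroup.index_comap_of_surjective _ hπ, Subgroup.comap_map_eq, sup_comm] at hdvd

open CategoryTheory in
theorem charInner_ker_eq_card_characterStabilizer {G A : Type} [Group G] [Finite G] [CommGroup A]
    (π : G →* A) (hπ : Function.Surjective π) (V : FDRep ℂ G) [Simple V] :
    charInner π.ker (fun n => V.character n) (fun n => V.character n) =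
      Nat.card (characterStabilizer π V.character) := by
  classical
  have := Fintype.ofFinite G
  have hA : Finite A := Finite.of_surjective π hπ
  have := Fintype.ofFinite (A →* ℂˣ)
  have hcard : (Nat.card G : ℂ) = Nat.card π.ker * Nat.card A := by
    rw [← Subgroup.card_mul_index π.ker, Subgroup.index_ker, MonoidHom.range_eq_top.2 hπ,
      Subgroup.card_top, Nat.cast_mul]
  have hsum : ∑ θ : A →* ℂˣ, (Nat.card G : ℂ)⁻¹ *
      ∑ g, ((θ.comp π) g : ℂ) * (V.character g * V.character g⁻¹) =
      Nat.card (characterStabilizer π V.character) := by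
    simp_rw [V.sum_linear_mul_character_mul_character_inv]
    rw [Finset.sum_boole, ← Fintype.card_subtype, ← Nat.card_eq_fintype_card]
    rfl
  rw [← hsum, ← Finset.mul_sum, Finset.sum_comm]
  simp_rw [← Finset.sum_mul, MonoidHom.comp_apply, CommGroup.sum_linear_apply, ite_mul, zero_mul]
  rw [← Finset.sum_filter, ← Finset.mul_sum, hcard, mul_inv, mul_assoc,
    inv_mul_cancel_left₀ (NeZero.ne _), charInner, finsum_eq_sum_of_fintype]
  congr 1
  simp_rw [← V.character_inv_eq_conj]
  exact (Finset.sum_subtype _ (fun g => by simp [MonoidHom.mem_ker])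
    (fun g => V.character g * V.character g⁻¹)).symm

/-- Let `N ⊴ G` with `G/N` abelian, `χ` an irreducible character of the finite
group `G`. Then `⟨Res_N χ, Res_N χ⟩_N` is a positive integer dividing the index
`[G : N · Z(G)]`. -/
theorem inner_res_dvd_index_sup_center
    (G : Type) [Group G] [Finite G] (N : Subgroup G) [N.Normal]
    (hab : ∀ a b : G ⧸ N, a * b = b * a)
    (χ : G → ℂ) (hχ : IsIrreducibleCharacter G χ) :
    ∃ r : ℕ, 0 < r ∧
      charInner N (fun n : N => χ n) (fun n : N => χ n) = (r : ℂ) ∧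
      r ∣ (N ⊔ Subgroup.center G).index := by
  obtain ⟨V, hV, rfl⟩ := hχ
  let _ : CommGroup (G ⧸ N) := { mul_comm := hab }
  have hπ := QuotientGroup.mk'_surjective N
  have hinner := charInner_ker_eq_card_characterStabilizer (QuotientGroup.mk' N) hπ V
  have hdvd := card_characterStabilizer_dvd_index (QuotientGroup.mk' N) hπ V.character
    fun _ hz => V.character_center_ne_zero hz
  rw [QuotientGroup.ker_mk'] at hdvd
  refine ⟨_, Nat.pos_of_dvd_of_pos hdvd (Nat.pos_of_ne_zero Subgroup.index_ne_zero_of_finite),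
    ?_, hdvd⟩
  rw [← hinner]
  congr! <;> exact (QuotientGroup.ker_mk' N).symm
end

section
/- Let q be a prime power, F a finite field with q elements, and n ≥ 1. For every complex irreducible character χ̃ of GL_n(F), the inner product ⟨Res χ̃, Res χ̃⟩ of the restriction of χ̃ to SL_n(F) with itself divides gcd(n, q−1). -/
open scoped BigOperators

open CategoryTheory

open scoped ComplexOrder in
/-- Averaging a Hermitian form: the character of a complex representation of a finite group
takes conjugate values at inverse elements. -/
theorem FDRep.conj_character {G : Type} [Group G] [Finite G] (V : FDRep ℂ G) (g : G) :
    (starRingEnd ℂ) (V.character g) = V.character g⁻¹ := by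
  classical
  have : Fintype G := Fintype.ofFinite G
  let b := Module.finBasis ℂ V
  let M : G →* Matrix (Fin (Module.finrank ℂ V)) (Fin (Module.finrank ℂ V)) ℂ :=
    (LinearMap.toMatrixAlgEquiv b : _ →* _).comp V.ρ
  have hM (h : G) : V.character h = (M h).trace := LinearMap.trace_eq_matrix_trace ℂ b (V.ρ h)
  let P := ∑ h : G, (M h).conjTranspose * M h
  have hP : P.PosDef := by
    have hP1 : P = 1 + ∑ h ∈ Finset.univ.erase (1 : G), (M h).conjTranspose * M h := by
      simp only [P]
      rw [← Finset.add_sum_erase _ _ (Finset.mem_univ (1 : G))]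
      simp
    rw [hP1]
    exact Matrix.PosDef.one.add_posSemidef
      (Matrix.posSemidef_sum _ fun h _ => Matrix.posSemidef_conjTranspose_mul_self _)
  have hPg : (M g).conjTranspose * P * M g = P := by
    simp only [P, Finset.mul_sum, Finset.sum_mul]
    refine Fintype.sum_equiv (Equiv.mulRight g) _ _ fun h => ?_
    simp [Matrix.mul_assoc]
  have hdet : IsUnit P.det := (Matrix.isUnit_iff_isUnit_det _).1 hP.isUnit
  have hgg : M g * M g⁻¹ = 1 := by rw [← map_mul]; simp
  have hinv : M g⁻¹ = P⁻¹ * ((M g).conjTranspose * P) := by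
    have h2 : (M g).conjTranspose * P = P * M g⁻¹ := by
      conv_rhs => rw [← hPg]
      rw [Matrix.mul_assoc _ (M g), hgg, Matrix.mul_one]
    rw [h2, Matrix.nonsing_inv_mul_cancel_left _ _ hdet]
  rw [hM, hM, hinv, Matrix.trace_mul_comm, Matrix.mul_assoc, Matrix.mul_nonsing_inv _ hdet,
    Matrix.mul_one, Matrix.trace_conjTranspose]
  rfl

/-- The twist of a representation by a linear character. -/
noncomputable def FDRep.twist_s6 {G : Type} [Group G] (V : FDRep ℂ G) (θ : G →* ℂˣ) : FDRep ℂ G :=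
  FDRep.of (V := V)
    { toFun := fun g => (θ g : ℂ) • V.ρ g
      map_one' := by simp
      map_mul' := fun g h => by
        rw [map_mul, map_mul, Units.val_mul, smul_mul_smul_comm] }

theorem FDRep.character_twist_s6 {G : Type} [Group G] (V : FDRep ℂ G) (θ : G →* ℂˣ) (g : G) :
    (V.twist_s6 θ).character g = θ g * V.character g :=
  map_smul (LinearMap.trace ℂ V) (θ g : ℂ) (V.ρ g)

theorem FDRep.simple_twist_s6 {G : Type} [Group G] [Finite G] (V : FDRep ℂ G) [Simple V]
    (θ : G →* ℂˣ) : Simple (V.twist_s6 θ) := by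
  have : Fintype G := Fintype.ofFinite G
  rw [FDRep.simple_iff_char_is_norm_one, ← (FDRep.simple_iff_char_is_norm_one V).1 ‹_›]
  refine Finset.sum_congr rfl fun g _ => ?_
  rw [FDRep.character_twist_s6, FDRep.character_twist_s6, mul_mul_mul_comm, ← Units.val_mul, ← map_mul]
  simp

/-- A simple representation has nonvanishing character at central elements. -/
theorem FDRep.character_ne_zero_of_mem_center {G : Type} [Group G] [Finite G] (V : FDRep ℂ G)
    [Simple V] {z : G} (hz : z ∈ Subgroup.center G) : V.character z ≠ 0 := by
  have : Fintype G := Fintype.ofFinite G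
  let f : V ⟶ V :=
    { hom := Action.ρ V z
      comm := fun g => by
        change Action.ρ V z * Action.ρ V g = Action.ρ V g * Action.ρ V z
        rw [← map_mul, ← map_mul, Subgroup.mem_center_iff.1 hz g] }
  obtain ⟨c, hc⟩ := (finrank_eq_one_iff_of_nonzero' (𝟙 V) (id_nonzero V)).1
    (finrank_endomorphism_simple_eq_one ℂ V) f
  have hρ : V.ρ z = c • LinearMap.id := by
    have := congrArg (fun f : V ⟶ V => f.hom.hom.hom) hc
    exact this.symm
  have hfin : (Module.finrank ℂ V : ℂ) ≠ 0 := by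
    intro h0
    have h0' : Module.finrank ℂ V = 0 := by exact_mod_cast h0
    have hsub : Subsingleton V := Module.finrank_zero_iff.1 h0'
    refine id_nonzero V ?_
    ext x
    exact Subsingleton.elim (α := V) _ _
  have hc0 : c ≠ 0 := by
    rintro rfl
    have h1 : V.ρ z * V.ρ z⁻¹ = 1 := by rw [← map_mul]; simp
    rw [hρ, zero_smul, zero_mul] at h1
    have h2 := congrArg (LinearMap.trace ℂ V) h1
    rw [map_zero, LinearMap.trace_one] at h2
    exact hfin h2.symm
  rw [FDRep.character, hρ, map_smul, LinearMap.trace_id]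
  exact mul_ne_zero hc0 hfin

/-- The linear characters of `A`, pulled back along `d`, that fix `V` up to isomorphism. -/
noncomputable def FDRep.twistStabilizer {G A : Type} [Group G] [CommGroup A] (V : FDRep ℂ G)
    (d : G →* A) : Subgroup (A →* ℂˣ) where
  carrier := {θ | ∀ g, (θ (d g) : ℂ) * V.character g = V.character g}
  one_mem' := fun g => by simp
  mul_mem' := fun {a b} ha hb g => by
    rw [MonoidHom.mul_apply, Units.val_mul, mul_assoc, hb g, ha g]
  inv_mem' := fun {a} ha g => by
    conv_lhs => rw [← ha g]
    simp

theorem FDRep.inner_twist {G A : Type} [Group G] [Fintype G] [CommGroup A] (V : FDRep ℂ G)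
    [Simple V] (d : G →* A) (θ : A →* ℂˣ) [Decidable (θ ∈ V.twistStabilizer d)] :
    ∑ g : G, (θ (d g) : ℂ) * (V.character g * V.character g⁻¹) =
      if θ ∈ V.twistStabilizer d then (Nat.card G : ℂ) else 0 := by
  have hV := (FDRep.simple_iff_char_is_norm_one V).1 ‹_›
  split_ifs with h
  · rw [← hV]
    refine Finset.sum_congr rfl fun g _ => ?_
    rw [← mul_assoc, h g]
  · have := V.simple_twist_s6 (θ.comp d)
    have hcard : (Nat.card G : ℂ) ≠ 0 := NeZero.ne _
    have := invertibleOfNonzero hcard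
    have ho := FDRep.char_orthonormal (V.twist_s6 (θ.comp d)) V
    rw [if_neg] at ho
    · have := (mul_eq_zero.1 ho).resolve_left (inv_ne_zero hcard)
      simpa [FDRep.character_twist_s6, mul_assoc] using this
    · rintro ⟨i⟩
      refine h fun g => ?_
      exact (V.character_twist_s6 (θ.comp d) g).symm.trans (congrFun (FDRep.char_iso i) g)

theorem sum_monoidHom_units_apply {A : Type} [CommGroup A] [Finite A] [Fintype (A →* ℂˣ)]
    [DecidableEq A] (a : A) :
    ∑ θ : A →* ℂˣ, (θ a : ℂ) = if a = 1 then (Nat.card A : ℂ) else 0 := by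
  split_ifs with h
  · subst h
    simp [← CommGroup.card_monoidHom_of_hasEnoughRootsOfUnity A ℂ]
  · obtain ⟨φ, hφ⟩ := CommGroup.exists_apply_ne_one_of_hasEnoughRootsOfUnity A ℂ h
    have key : (φ a : ℂ) * ∑ θ : A →* ℂˣ, (θ a : ℂ) = ∑ θ : A →* ℂˣ, (θ a : ℂ) := by
      rw [Finset.mul_sum]
      exact Fintype.sum_equiv (Equiv.mulLeft φ) _ _ fun θ => by simp
    by_contra h0
    exact hφ (Units.ext (mul_right_cancel₀ h0 (key.trans (one_mul _).symm)))

/-- The norm of a simple character restricted to the kernel of a surjection onto an abelian group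
counts the linear characters of the quotient which fix it. -/
theorem FDRep.sum_ker_character {G A : Type} [Group G] [Fintype G] [CommGroup A] [Finite A]
    (V : FDRep ℂ G) [Simple V] (d : G →* A) (hd : Function.Surjective d) [Fintype d.ker] :
    ∑ g : d.ker, V.character g * V.character (g : G)⁻¹ =
      Nat.card d.ker * Nat.card (V.twistStabilizer d) := by
  classical
  have : Finite (A →* ℂˣ) :=
    .of_equiv A (CommGroup.monoidHom_mulEquiv_of_hasEnoughRootsOfUnity A ℂ).some.symm.toEquiv
  have : Fintype (A →* ℂˣ) := Fintype.ofFinite _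
  have hA : (Nat.card A : ℂ) ≠ 0 := NeZero.ne _
  have hG : Nat.card G = Nat.card A * Nat.card d.ker := by
    rw [Subgroup.card_eq_card_quotient_mul_card_subgroup d.ker,
      Nat.card_congr (QuotientGroup.quotientKerEquivOfSurjective d hd).toEquiv]
  have h1 : ∑ g : G, (∑ θ : A →* ℂˣ, (θ (d g) : ℂ)) * (V.character g * V.character g⁻¹) =
      Nat.card A * ∑ g : d.ker, V.character g * V.character (g : G)⁻¹ := by
    simp_rw [sum_monoidHom_units_apply, ite_mul, zero_mul]
    rw [← Finset.sum_filter, ← Finset.mul_sum]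
    congr 1
    refine Finset.sum_subtype _ (fun g => ?_) _
    simp [MonoidHom.mem_ker]
  have h2 : ∑ g : G, (∑ θ : A →* ℂˣ, (θ (d g) : ℂ)) * (V.character g * V.character g⁻¹) =
      Nat.card (V.twistStabilizer d) * Nat.card G := by
    simp_rw [Finset.sum_mul]
    rw [Finset.sum_comm]
    simp_rw [FDRep.inner_twist]
    rw [← Finset.sum_filter, Finset.sum_const, nsmul_eq_mul, ← Fintype.card_subtype,
      ← Nat.card_eq_fintype_card]
  refine mul_left_cancel₀ hA ?_
  rw [← h1, h2, hG]
  push_cast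
  ring

/-- The order of the twist stabilizer of a simple representation of `GLₙ(F)` divides
`gcd(n, |Fˣ|)`. -/
theorem FDRep.card_twistStabilizer_det_dvd {F : Type} [Field F] [Finite F] (n : ℕ)
    (V : FDRep ℂ (Matrix.GeneralLinearGroup (Fin n) F)) [Simple V] :
    Nat.card (V.twistStabilizer Matrix.GeneralLinearGroup.det) ∣ Nat.gcd n (Nat.card Fˣ) := by
  let e := (CommGroup.monoidHom_mulEquiv_of_hasEnoughRootsOfUnity Fˣ ℂ).some
  have : Finite (Fˣ →* ℂˣ) := .of_equiv Fˣ e.symm.toEquiv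
  have : IsCyclic (Fˣ →* ℂˣ) := isCyclic_of_surjective e.symm e.symm.surjective
  refine Nat.dvd_gcd ?_ ?_
  · rw [← IsCyclic.exponent_eq_card]
    refine Monoid.exponent_dvd_of_forall_pow_eq_one fun ⟨θ, hθ⟩ => Subtype.ext ?_
    ext1 z
    have hz : Matrix.GeneralLinearGroup.scalar (Fin n) z ∈
        Subgroup.center (Matrix.GeneralLinearGroup (Fin n) F) :=
      Subgroup.mem_center_iff.2 fun A => (Matrix.GeneralLinearGroup.scalar_commute z A).symm
    have h := mul_right_cancel₀ (V.character_ne_zero_of_mem_center hz)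
      ((hθ _).trans (one_mul _).symm)
    rw [Matrix.GeneralLinearGroup.det_scalar, Fintype.card_fin, map_pow] at h
    exact Units.ext h
  · rw [← CommGroup.card_monoidHom_of_hasEnoughRootsOfUnity Fˣ ℂ]
    exact Subgroup.card_subgroup_dvd_card _

/-- `SLₙ(F)` as the kernel of the determinant. -/
noncomputable def Matrix.SpecialLinearGroup.equivKerDet (n : ℕ) (F : Type) [Field F] :
    Matrix.SpecialLinearGroup (Fin n) F ≃
      (Matrix.GeneralLinearGroup.det : Matrix.GeneralLinearGroup (Fin n) F →* Fˣ).ker :=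
  Equiv.ofBijective
    (fun A => ⟨Matrix.SpecialLinearGroup.toGL A,
      MonoidHom.mem_ker.2 (Units.ext (by simp))⟩)
    ⟨fun A B h => Matrix.SpecialLinearGroup.toGL_injective (congrArg Subtype.val h),
      fun ⟨g, hg⟩ => ⟨⟨g, by simpa using congrArg Units.val (MonoidHom.mem_ker.1 hg)⟩,
        Subtype.ext (Units.ext rfl)⟩⟩

/-- For any irreducible complex character `χ` of `GLₙ(F_q)`, the self inner product
of the restriction of `χ` to `SLₙ(F_q)` (i.e. the number of irreducible
constituents of the restriction) divides `gcd(n, q - 1)`. -/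
theorem inner_res_GL_to_SL_dvd_gcd
    (q : ℕ) (hq : IsPrimePow q) (F : Type) [Field F] [Fintype F]
    (hcard : Fintype.card F = q) (n : ℕ) (hn : 1 ≤ n)
    (χ : Matrix.GeneralLinearGroup (Fin n) F → ℂ)
    (hχ : IsIrreducibleCharacter (Matrix.GeneralLinearGroup (Fin n) F) χ) :
    ∃ r : ℕ,
      charInner (Matrix.SpecialLinearGroup (Fin n) F)
          (fun A => χ (Matrix.SpecialLinearGroup.toGL A))
          (fun A => χ (Matrix.SpecialLinearGroup.toGL A)) = (r : ℂ) ∧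
      r ∣ Nat.gcd n (q - 1) := by
  classical
  obtain ⟨V, hV, rfl⟩ := hχ
  let d : Matrix.GeneralLinearGroup (Fin n) F →* Fˣ := Matrix.GeneralLinearGroup.det
  have hd : Function.Surjective d := fun u => by
    have : NeZero n := ⟨by omega⟩
    refine ⟨Matrix.GeneralLinearGroup.mkOfDetNeZero
      (Matrix.diagonal (Function.update 1 (0 : Fin n) (u : F))) ?_, ?_⟩
    · simp [Matrix.det_diagonal, Finset.prod_update_of_mem]
    · ext
      simp [d, Matrix.GeneralLinearGroup.mkOfDetNeZero, Matrix.det_diagonal,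
        Finset.prod_update_of_mem]
  have : Fintype d.ker := Fintype.ofFinite _
  let e : Matrix.SpecialLinearGroup (Fin n) F ≃ d.ker :=
    Matrix.SpecialLinearGroup.equivKerDet n F
  refine ⟨Nat.card (V.twistStabilizer d), ?_, ?_⟩
  · have hk : (Nat.card d.ker : ℂ) ≠ 0 := NeZero.ne _
    have hsum := V.sum_ker_character d hd
    rw [charInner, finsum_eq_sum_of_fintype, Nat.card_congr e, inv_mul_eq_iff_eq_mul₀ hk, ← hsum]
    refine Fintype.sum_equiv e _ _ fun A => ?_
    rw [FDRep.conj_character]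
    rfl
  · rw [← hcard, ← Fintype.card_units, ← Nat.card_eq_fintype_card]
    exact V.card_twistStabilizer_det_dvd n
end
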